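/- arXiv:1811.02699 — 2 statements merged into one kernel-verified Lean document; each statement's English description precedes it below -/
import Mathlib

section
/- Let G be a finite signed graph with an almost valid drawing D in the circumference. Then G has a valid drawing in the circumference. -/
open Real Set

noncomputable def cmod (x : ℝ) : ℝ := x - 2 * π * ⌊x / (2 * π)⌋

noncomputable def cdist (p q : ℝ) : ℝ := min (cmod (p - q)) (cmod (q - p))

def Mr (p : ℝ) : Set ℝ := {x | ∃ t, 0 ≤ t ∧ t ≤ π ∧ x = cmod (p + t)}
def Ml (p : ℝ) : Set ℝ := {x | ∃ t, 0 ≤ t ∧ t ≤ π ∧ x = cmod (p - t)}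

structure SignedGraph (V : Type*) where
  pos : SimpleGraph V
  neg : SimpleGraph V
  disjoint : ∀ i j, ¬ (pos.Adj i j ∧ neg.Adj i j)

def IsDrawing {V : Type*} (D : V → ℝ) : Prop :=
  Function.Injective D ∧ ∀ v, D v ∈ Set.Ico (0 : ℝ) (2 * π)

def IsValidDrawing {V : Type*} (G : SignedGraph V) (D : V → ℝ) : Prop :=
  IsDrawing D ∧ ∀ i j k, G.pos.Adj i j → G.neg.Adj i k →
    cdist (D i) (D j) < cdist (D i) (D k)

def IsAlmostValidDrawing {V : Type*} (G : SignedGraph V) (D : V → ℝ) : Prop :=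
  IsDrawing D ∧ ∃ δ > 0, ∀ i j k, G.pos.Adj i j → G.neg.Adj i k →
    cdist (D i) (D j) ≤ δ ∧ δ ≤ cdist (D i) (D k)

def arcC (s ℓ : ℝ) : Set ℝ := {x | x ∈ Set.Ico (0 : ℝ) (2 * π) ∧ cmod (x - s) ≤ ℓ}

def arcGen (s ℓ : ℝ) (inl inr : Bool) : Set ℝ :=
  {x | x ∈ Set.Ico (0 : ℝ) (2 * π) ∧
    (inl = false → 0 < cmod (x - s)) ∧
    (inr = true → cmod (x - s) ≤ ℓ) ∧ (inr = false → cmod (x - s) < ℓ)}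

def IsCircularArcModel {V : Type*} (G : SimpleGraph V) (A : V → Set ℝ) : Prop :=
  (∀ v, ∃ s ℓ, 0 < ℓ ∧ ℓ < 2 * π ∧ A v = arcC s ℓ) ∧
  ∀ i j, i ≠ j → (G.Adj i j ↔ (A i ∩ A j).Nonempty)

def IsCircularArcGraph {V : Type*} (G : SimpleGraph V) : Prop :=
  ∃ A, IsCircularArcModel G A

def IsProperCircularArcGraph {V : Type*} (G : SimpleGraph V) : Prop :=
  ∃ A : V → Set ℝ, IsCircularArcModel G A ∧ ∀ i j, ¬ A i ⊂ A j

noncomputable def ff (t : ℝ) : ℝ := min (cmod t) (cmod (-t))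

lemma cdist_eq (p q : ℝ) : cdist p q = ff (p - q) := by
  unfold cdist ff; rw [neg_sub]

lemma cmod_mem (t : ℝ) : 0 ≤ cmod t ∧ cmod t < 2 * π := by
  have hp : 0 < 2 * π := by positivity
  have h1 := Int.floor_le (t / (2 * π))
  have h2 := Int.lt_floor_add_one (t / (2 * π))
  rw [le_div_iff₀ hp] at h1
  rw [div_lt_iff₀ hp] at h2
  unfold cmod
  constructor <;> linarith

lemma cmod_ex (t : ℝ) : ∃ n : ℤ, cmod t = t - 2 * π * n := ⟨_, rfl⟩

lemma cmod_le (t : ℝ) (n : ℤ) (h : 0 ≤ t - 2 * π * n) : cmod t ≤ t - 2 * π * n := by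
  have hp : 0 < 2 * π := by positivity
  have : n ≤ ⌊t / (2 * π)⌋ := by
    rw [Int.le_floor, le_div_iff₀ hp]; linarith
  have h2 : (n : ℝ) ≤ (⌊t / (2 * π)⌋ : ℝ) := by exact_mod_cast this
  unfold cmod
  have := mul_le_mul_of_nonneg_left h2 hp.le
  linarith

lemma ff_le (t : ℝ) (n : ℤ) : ff t ≤ |t - 2 * π * n| := by
  rcases le_total 0 (t - 2 * π * n) with h | h
  · rw [abs_of_nonneg h]
    exact (min_le_left _ _).trans (cmod_le t n h)
  · rw [abs_of_nonpos h]
    refine (min_le_right _ _).trans ?_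
    have := cmod_le (-t) (-n) (by push_cast; linarith)
    push_cast at this
    linarith

lemma ff_ex (t : ℝ) : ∃ n : ℤ, ff t = |t - 2 * π * n| := by
  unfold ff
  rcases min_choice (cmod t) (cmod (-t)) with h | h <;> rw [h]
  · obtain ⟨n, hn⟩ := cmod_ex t
    refine ⟨n, ?_⟩
    rw [← hn, abs_of_nonneg (cmod_mem t).1]
  · obtain ⟨n, hn⟩ := cmod_ex (-t)
    refine ⟨-n, ?_⟩
    have : t - 2 * π * ((-n : ℤ) : ℝ) = - cmod (-t) := by rw [hn]; push_cast; ring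
    rw [this, abs_neg, abs_of_nonneg (cmod_mem _).1]

lemma ff_le_pi (t : ℝ) : ff t ≤ π := by
  obtain ⟨n, hn⟩ := cmod_ex t
  have h0 := cmod_mem t
  have h1 := ff_le t n
  have h2 := ff_le t (n + 1)
  rw [← hn, abs_of_nonneg h0.1] at h1
  have : t - 2 * π * ((n + 1 : ℤ) : ℝ) = - (2 * π - cmod t) := by rw [hn]; push_cast; ring
  rw [this, abs_neg, abs_of_nonneg (by linarith)] at h2
  linarith

lemma ff_self (s : ℝ) (h0 : 0 ≤ s) (h1 : s ≤ π) : ff s = s := by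
  apply le_antisymm
  · have := ff_le s 0
    simpa [abs_of_nonneg h0] using this
  · obtain ⟨n, hn⟩ := ff_ex s
    rw [hn]
    have hp := pi_pos
    rcases lt_trichotomy n 0 with h | h | h
    · have h' : (n : ℝ) ≤ -1 := by exact_mod_cast (by omega : n ≤ -1)
      refine le_trans ?_ (le_abs_self _)
      nlinarith
    · simp [h, abs_of_nonneg h0]
    · have h' : (1 : ℝ) ≤ n := by exact_mod_cast h
      refine le_trans ?_ (neg_le_abs _)
      nlinarith

lemma ff_lip (s t : ℝ) : ff s ≤ ff t + |s - t| := by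
  obtain ⟨n, hn⟩ := ff_ex t
  have := ff_le s n
  rw [hn]
  have h2 := abs_add_le (t - 2 * π * n) (s - t)
  have : t - 2 * π * n + (s - t) = s - 2 * π * n := by ring
  rw [this] at h2
  linarith

lemma ff_per (t : ℝ) (m : ℤ) : ff (t + 2 * π * m) = ff t := by
  apply le_antisymm
  · obtain ⟨n, hn⟩ := ff_ex t
    have := ff_le (t + 2 * π * m) (n + m)
    rw [hn]; refine this.trans (le_of_eq (congrArg _ ?_)); push_cast; ring
  · obtain ⟨n, hn⟩ := ff_ex (t + 2 * π * m)
    have := ff_le t (n - m)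
    rw [hn]; refine this.trans (le_of_eq (congrArg _ ?_)); push_cast; ring

lemma ff_neg (t : ℝ) : ff (-t) = ff t := by
  unfold ff; rw [neg_neg, min_comm]

lemma cdist_cmod (a b : ℝ) : cdist (cmod a) (cmod b) = ff (a - b) := by
  rw [cdist_eq]
  obtain ⟨n, hn⟩ := cmod_ex a
  obtain ⟨m, hm⟩ := cmod_ex b
  rw [hn, hm, ← ff_per (a - b) (m - n)]
  congr 1; push_cast; ring

/-- `D v` follows `D u` at signed angle `s`. -/
def Nx {V : Type*} (D : V → ℝ) (s : ℝ) (u v : V) : Prop := ∃ n : ℤ, D v - D u = s + 2 * π * n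

def PP {V : Type*} (G : SignedGraph V) (D : V → ℝ) (δ s : ℝ) (i : V) : Prop :=
  ∃ j k, G.pos.Adj i j ∧ G.neg.Adj i k ∧ Nx D (s * δ) i j ∧ Nx D (s * δ) k i

lemma eq_of_mod {V : Type*} {D : V → ℝ} (hD : IsDrawing D) {u v : V} {n : ℤ}
    (h : D u - D v = 2 * π * n) : u = v := by
  apply hD.1
  have hu := hD.2 u
  have hv := hD.2 v
  have hp := pi_pos
  rw [Set.mem_Ico] at hu hv
  have h1 : n < 1 := by
    by_contra hc
    have : (1 : ℝ) ≤ n := by exact_mod_cast not_lt.mp hc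
    nlinarith
  have h2 : -1 < n := by
    by_contra hc
    have : (n : ℝ) ≤ -1 := by exact_mod_cast not_lt.mp hc
    nlinarith
  have : n = 0 := by omega
  subst this
  simp at h; linarith

lemma Nx.right {V : Type*} {D : V → ℝ} (hD : IsDrawing D) {s : ℝ} {u v w : V}
    (h : Nx D s u v) (h' : Nx D s u w) : v = w := by
  obtain ⟨n, hn⟩ := h
  obtain ⟨m, hm⟩ := h'
  apply eq_of_mod hD (n := n - m); push_cast; linarith

lemma Nx.left {V : Type*} {D : V → ℝ} (hD : IsDrawing D) {s : ℝ} {u v w : V}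
    (h : Nx D s u w) (h' : Nx D s v w) : u = v := by
  obtain ⟨n, hn⟩ := h
  obtain ⟨m, hm⟩ := h'
  apply eq_of_mod hD (n := m - n); push_cast; linarith

lemma Nx.swap {V : Type*} {D : V → ℝ} {s : ℝ} {u v : V}
    (h : Nx D s u v) : Nx D (-s) v u := by
  obtain ⟨n, hn⟩ := h
  exact ⟨-n, by push_cast; linarith⟩

lemma nx_of_ff {V : Type*} {D : V → ℝ} {δ : ℝ} {u v : V}
    (h : ff (D u - D v) = δ) : Nx D δ u v ∨ Nx D (-δ) u v := by
  obtain ⟨n, hn⟩ := ff_ex (D u - D v)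
  rw [h] at hn
  rcases abs_choice (D u - D v - 2 * π * n) with h1 | h1 <;> rw [h1] at hn
  · right; exact ⟨-n, by push_cast; linarith⟩
  · left; exact ⟨-n, by push_cast; linarith⟩

open Classical in
noncomputable def xx {V : Type*} (G : SignedGraph V) (D : V → ℝ) (δ : ℝ) (i : V) : ℝ :=
  if PP G D δ 1 i then 1 else if PP G D δ (-1) i then -1 else 0

lemma xx_abs {V : Type*} (G : SignedGraph V) (D : V → ℝ) (δ : ℝ) (i : V) :
    |xx G D δ i| ≤ 1 := by
  unfold xx; split_ifs <;> simp

lemma PP_excl {V : Type*} {G : SignedGraph V} {D : V → ℝ} (hD : IsDrawing D) {δ : ℝ} {i : V}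
    (h : PP G D δ 1 i) (h' : PP G D δ (-1) i) : False := by
  obtain ⟨j, k, hj, hk, h1, h2⟩ := h
  obtain ⟨j', k', hj', hk', h1', h2'⟩ := h'
  have h3 := h2'.swap
  rw [show -(-1 * δ) = 1 * δ by ring] at h3
  have := h1.right hD h3
  subst this
  exact G.disjoint _ _ ⟨hj, hk'⟩

lemma xx_of_PP {V : Type*} {G : SignedGraph V} {D : V → ℝ} (hD : IsDrawing D) {δ s : ℝ} {i : V}
    (hs : s = 1 ∨ s = -1) (h : PP G D δ s i) : s * xx G D δ i = 1 := by
  rcases hs with rfl | rfl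
  · simp [xx, h]
  · have : ¬ PP G D δ 1 i := fun h' => PP_excl hD h' h
    simp [xx, h, this]

lemma xx_of_not {V : Type*} {G : SignedGraph V} {D : V → ℝ} {δ s : ℝ} {i : V}
    (hs : s = 1 ∨ s = -1) (h : ¬ PP G D δ s i) : s * xx G D δ i ≤ 0 := by
  rcases hs with rfl | rfl
  · unfold xx; split_ifs <;> simp_all
  · unfold xx; split_ifs <;> simp_all

lemma core {V : Type*} {G : SignedGraph V} {D : V → ℝ} (hD : IsDrawing D) {δ s ε : ℝ} {i j k : V}
    (hs : s = 1 ∨ s = -1) (hj : G.pos.Adj i j) (hk : G.neg.Adj i k)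
    (h1 : Nx D (s * δ) i j) (h2 : Nx D (s * δ) k i) (hε : 0 < ε) (hε1 : 2 * ε < δ)
    (hε2 : 2 * ε < π - δ) :
    ff ((D i + ε * xx G D δ i) - (D j + ε * xx G D δ j)) <
      ff ((D i + ε * xx G D δ i) - (D k + ε * xx G D δ k)) := by
  have xi := xx_of_PP hD hs ⟨j, k, hj, hk, h1, h2⟩
  have xj : s * xx G D δ j ≤ 0 := by
    apply xx_of_not hs
    rintro ⟨j', k', hj', hk', h1', h2'⟩
    have := h1.left hD h2'
    subst this
    exact G.disjoint _ _ ⟨hj, hk'.symm⟩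
  have xk : s * xx G D δ k ≤ 0 := by
    apply xx_of_not hs
    rintro ⟨j', k', hj', hk', h1', h2'⟩
    have := h2.right hD h1'
    subst this
    exact G.disjoint _ _ ⟨hj'.symm, hk⟩
  have bj := abs_le.1 (xx_abs G D δ j)
  have bk := abs_le.1 (xx_abs G D δ k)
  obtain ⟨n, hn⟩ := h1
  obtain ⟨m, hm⟩ := h2
  have e1 : ff ((D i + ε * xx G D δ i) - (D j + ε * xx G D δ j)) =
      ff (δ + ε * (s * xx G D δ j - 1)) := by
    rw [← xi]
    rcases hs with rfl | rfl
    · rw [← ff_neg, ← ff_per (δ + _) n]; congr 1; linear_combination hn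
    · rw [← ff_per (δ + _) (-n)]; congr 1; push_cast; linear_combination -hn
  have e2 : ff ((D i + ε * xx G D δ i) - (D k + ε * xx G D δ k)) =
      ff (δ + ε * (1 - s * xx G D δ k)) := by
    rw [← xi]
    rcases hs with rfl | rfl
    · rw [← ff_per (δ + _) m]; congr 1; linear_combination hm
    · rw [← ff_neg, ← ff_per (δ + _) (-m)]; congr 1; push_cast; linear_combination -hm
  have cj : -1 ≤ s * xx G D δ j := by rcases hs with rfl | rfl <;> linarith
  have ck : -1 ≤ s * xx G D δ k := by rcases hs with rfl | rfl <;> linarith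
  rw [e1, e2, ff_self _ (by nlinarith) (by nlinarith), ff_self _ (by nlinarith) (by nlinarith)]
  nlinarith

lemma ff_move {V : Type*} (G : SignedGraph V) (D : V → ℝ) (δ ε : ℝ) (hε : 0 < ε) (i j : V) :
    |ff ((D i + ε * xx G D δ i) - (D j + ε * xx G D δ j)) - ff (D i - D j)| ≤ 2 * ε := by
  have h1 := ff_lip ((D i + ε * xx G D δ i) - (D j + ε * xx G D δ j)) (D i - D j)
  have h2 := ff_lip (D i - D j) ((D i + ε * xx G D δ i) - (D j + ε * xx G D δ j))
  rw [abs_sub_comm] at h2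
  have bi := abs_le.1 (xx_abs G D δ i)
  have bj := abs_le.1 (xx_abs G D δ j)
  have : |(D i + ε * xx G D δ i) - (D j + ε * xx G D δ j) - (D i - D j)| ≤ 2 * ε := by
    rw [abs_le]; constructor <;> nlinarith
  rw [abs_le]; constructor <;> linarith

lemma ev_lt {c : ℝ} (hc : 0 < c) : ∀ᶠ ε in nhdsWithin (0 : ℝ) (Set.Ioi 0), 4 * ε < c := by
  have : Set.Ioo (0 : ℝ) (c / 4) ∈ nhdsWithin (0 : ℝ) (Set.Ioi 0) :=
    Ioo_mem_nhdsGT (by positivity)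
  filter_upwards [this] with ε h
  linarith [h.2]

/-- If a finite signed graph has an almost valid drawing in the circumference,
then it has a valid drawing in the circumference. -/
theorem valid_of_almost_valid {V : Type*} [Fintype V]
    (G : SignedGraph V) (D : V → ℝ) (h : IsAlmostValidDrawing G D) :
    ∃ D' : V → ℝ, IsValidDrawing G D' := by
  obtain ⟨hD, δ, hδ, H⟩ := h
  have hinj : ∀ᶠ ε in nhdsWithin (0 : ℝ) (Set.Ioi 0), ∀ i j, i ≠ j →
      4 * ε < ff (D i - D j) := by
    rw [Filter.eventually_all]; intro i
    rw [Filter.eventually_all]; intro j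
    by_cases hij : i = j
    · simp [hij]
    · obtain ⟨n, hn⟩ := ff_ex (D i - D j)
      have : 0 < ff (D i - D j) := by
        rw [hn, abs_pos]
        intro h0
        exact hij (eq_of_mod hD (n := n) (by linarith))
      filter_upwards [ev_lt this] with ε h _ using h
  have hmain : ∀ᶠ ε in nhdsWithin (0 : ℝ) (Set.Ioi 0), ∀ i j k, G.pos.Adj i j → G.neg.Adj i k →
      ff ((D i + ε * xx G D δ i) - (D j + ε * xx G D δ j)) <
      ff ((D i + ε * xx G D δ i) - (D k + ε * xx G D δ k)) := by
    rw [Filter.eventually_all]; intro i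
    rw [Filter.eventually_all]; intro j
    rw [Filter.eventually_all]; intro k
    by_cases hj : G.pos.Adj i j
    swap
    · simp [hj]
    by_cases hk : G.neg.Adj i k
    swap
    · simp [hk]
    obtain ⟨a, b⟩ := H i j k hj hk
    rw [cdist_eq] at a b
    rcases (a.trans b).lt_or_eq with hlt | heq
    · filter_upwards [ev_lt (sub_pos.2 hlt), self_mem_nhdsWithin] with ε h1 h0 _ _
      have m1 := abs_le.1 (ff_move G D δ ε h0 i j)
      have m2 := abs_le.1 (ff_move G D δ ε h0 i k)
      linarith
    · have ha : ff (D i - D j) = δ := by linarith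
      have hb : ff (D i - D k) = δ := by linarith
      have hjk : j ≠ k := by
        rintro rfl; exact G.disjoint _ _ ⟨hj, hk⟩
      have hcase : ∃ s : ℝ, (s = 1 ∨ s = -1) ∧ Nx D (s * δ) i j ∧ Nx D (s * δ) k i := by
        rcases nx_of_ff ha with h1 | h1 <;> rcases nx_of_ff hb with h2 | h2
        · exact absurd (h1.right hD h2) hjk
        · refine ⟨1, Or.inl rfl, by simpa using h1, by simpa using h2.swap⟩
        · refine ⟨-1, Or.inr rfl, by simpa using h1, by simpa using h2.swap⟩
        · exact absurd (h1.right hD h2) hjk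
      obtain ⟨s, hs, h1, h2⟩ := hcase
      have hpi : δ < π := by
        refine lt_of_le_of_ne (ha ▸ ff_le_pi _) ?_
        rintro rfl
        apply hjk
        obtain ⟨n, hn⟩ := h1
        obtain ⟨m, hm⟩ := h2
        rcases hs with rfl | rfl
        · apply eq_of_mod hD (n := n + m + 1); push_cast; linarith
        · apply eq_of_mod hD (n := n + m - 1); push_cast; linarith
      filter_upwards [ev_lt hδ, ev_lt (sub_pos.2 hpi), self_mem_nhdsWithin] with ε e1 e2 e0 _ _
      have e0' : 0 < ε := e0
      exact core hD hs hj hk h1 h2 e0 (by linarith) (by linarith)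
  have hpos : ∀ᶠ ε in nhdsWithin (0 : ℝ) (Set.Ioi 0), 0 < ε := self_mem_nhdsWithin
  obtain ⟨ε, h1, h2, h0⟩ := (hinj.and (hmain.and hpos)).exists
  refine ⟨fun v => cmod (D v + ε * xx G D δ v), ⟨?_, fun v => cmod_mem _⟩, ?_⟩
  · intro i j hij
    by_contra hne
    have h3 := h1 i j hne
    have m1 := abs_le.1 (ff_move G D δ ε h0 i j)
    rw [← cdist_cmod] at m1
    simp only at hij
    rw [hij, cdist_cmod, sub_self, ff_self 0 le_rfl pi_pos.le] at m1
    linarith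
  · intro i j k hj hk
    simp only [cdist_cmod]
    exact h2 i j k hj hk
end

section
/- A complete signed graph G has a valid drawing in the circumference if and only if its positive subgraph G⁺ is a proper circular arc graph. -/
open Real Set

namespace PCA

/-- Fourier–Motzkin elimination for strict difference constraints. -/
theorem fm {V Γ : Type*} [DecidableEq V] [AddCommGroup Γ] [LinearOrder Γ] [IsOrderedAddMonoid Γ]
    [DenselyOrdered Γ] [NoMaxOrder Γ] [NoMinOrder Γ]
    (P : V → V → Γ → Prop) (htr : ∀ i j k a b, P i j a → P j k b → P i k (a + b))
    (hpos : ∀ i a, P i i a → 0 < a) (T : Finset V) :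
    ∀ E : Finset (V × V × Γ), (∀ z ∈ E, P z.1 z.2.1 z.2.2 ∧ z.1 ∈ T ∧ z.2.1 ∈ T) →
      ∃ x : V → Γ, ∀ z ∈ E, x z.2.1 - x z.1 < z.2.2 := by
  classical
  induction T using Finset.induction_on with
  | empty =>
    intro E hE
    exact ⟨fun _ => 0, fun z hz => by simpa using (hE z hz).2.1⟩
  | insert v T hv ih =>
    intro E hE
    let E0 := E.filter (fun z => z.1 ≠ v ∧ z.2.1 ≠ v)
    let Ein := E.filter (fun z => z.1 ≠ v ∧ z.2.1 = v)
    let Eout := E.filter (fun z => z.1 = v ∧ z.2.1 ≠ v)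
    let E1 := (Ein ×ˢ Eout).image (fun q => (q.1.1, q.2.2.1, q.1.2.2 + q.2.2.2))
    obtain ⟨x, hx⟩ := ih (E0 ∪ E1) (by
      intro z hz
      rcases Finset.mem_union.1 hz with h | h
      · have h' := Finset.mem_filter.1 h
        have := hE z h'.1
        refine ⟨this.1, ?_, ?_⟩
        · exact (Finset.mem_insert.1 this.2.1).resolve_left h'.2.1
        · exact (Finset.mem_insert.1 this.2.2).resolve_left h'.2.2
      · obtain ⟨⟨q1, q2⟩, hq, rfl⟩ := Finset.mem_image.1 h
        obtain ⟨h1, h2⟩ := Finset.mem_product.1 hq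
        have h1 := Finset.mem_filter.1 h1
        have h2 := Finset.mem_filter.1 h2
        have a1 := hE _ h1.1
        have a2 := hE _ h2.1
        refine ⟨htr _ v _ _ _ ?_ ?_, ?_, ?_⟩
        · have := a1.1; rwa [h1.2.2] at this
        · have := a2.1; rwa [h2.2.1] at this
        · exact (Finset.mem_insert.1 a1.2.1).resolve_left h1.2.1
        · exact (Finset.mem_insert.1 a2.2.2).resolve_left h2.2.2)
    obtain ⟨y, hy1, hy2⟩ := Order.exists_between_finsets
      (lo := Eout.image (fun z => x z.2.1 - z.2.2)) (hi := Ein.image (fun z => x z.1 + z.2.2)) (by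
        intro a ha b hb
        obtain ⟨q2, hq2, rfl⟩ := Finset.mem_image.1 ha
        obtain ⟨q1, hq1, rfl⟩ := Finset.mem_image.1 hb
        have := hx (q1.1, q2.2.1, q1.2.2 + q2.2.2) (Finset.mem_union_right _
          (Finset.mem_image.2 ⟨(q1, q2), Finset.mem_product.2 ⟨hq1, hq2⟩, rfl⟩))
        simp only at this
        rw [sub_lt_iff_lt_add] at this ⊢
        calc _ < _ := this
          _ = _ := by abel)
    refine ⟨Function.update x v y, fun z hz => ?_⟩
    by_cases h1 : z.1 = v <;> by_cases h2 : z.2.1 = v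
    · rw [h1, h2, sub_self]
      have := (hE z hz).1
      rw [h1, h2] at this
      exact hpos _ _ this
    · have := hy1 _ (Finset.mem_image.2 ⟨z, Finset.mem_filter.2 ⟨hz, h1, h2⟩, rfl⟩)
      rw [h1, Function.update_self, Function.update_of_ne h2]
      rw [sub_lt_iff_lt_add] at this ⊢
      rwa [add_comm]
    · have := hy2 _ (Finset.mem_image.2 ⟨z, Finset.mem_filter.2 ⟨hz, h1, h2⟩, rfl⟩)
      rw [h2, Function.update_self, Function.update_of_ne h1]
      rw [sub_lt_iff_lt_add]
      rwa [add_comm]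
    · rw [Function.update_of_ne h1, Function.update_of_ne h2]
      exact hx z (Finset.mem_union_left _ (Finset.mem_filter.2 ⟨hz, h1, h2⟩))

/-- Lexicographic order on the lifted vertices. -/
def ltL {V : Type*} (p : V → ℝ) (τ : V → ℕ) (i : V) (a : ℤ) (j : V) (b : ℤ) : Prop :=
  p i + a < p j + b ∨ (p i + a = p j + b ∧ τ i < τ j)

inductive Stp {V : Type*} (p e : V → ℝ) (τ : V → ℕ) : V → V → ℤ → ℤ → Prop
  | fwd (i j : V) (w : ℤ) : p j + w ≤ e i → Stp p e τ i j 1 w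
  | bwd (i j : V) (w : ℤ) : e j + w < p i → Stp p e τ i j (-1) w
  | dn (i j : V) (w : ℤ) : ltL p τ j w i 0 → Stp p e τ i j 0 w

inductive Rch {V : Type*} (p e : V → ℝ) (τ : V → ℕ) : V → V → ℤ → ℤ → Prop
  | single {i j : V} {s w : ℤ} : Stp p e τ i j s w → Rch p e τ i j s w
  | snoc {i j k : V} {s w s' w' : ℤ} : Rch p e τ i j s w → Stp p e τ j k s' w' →
      Rch p e τ i k (s + s') (w + w')

theorem Rch.trans {V : Type*} {p e : V → ℝ} {τ : V → ℕ} {i j k : V} {s w s' w' : ℤ}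
    (h : Rch p e τ i j s w) (h' : Rch p e τ j k s' w') : Rch p e τ i k (s + s') (w + w') := by
  induction h' with
  | single h' => exact h.snoc h'
  | snoc _ h2 ih => rw [← add_assoc, ← add_assoc]; exact ih.snoc h2

theorem Rch.pow {V : Type*} {p e : V → ℝ} {τ : V → ℕ} {i : V} {s w : ℤ}
    (h : Rch p e τ i i s w) (n : ℕ) : Rch p e τ i i ((n + 1) * s) ((n + 1) * w) := by
  induction n with
  | zero => simpa using h
  | succ n ih =>
    have := ih.trans h
    push_cast
    convert this using 1 <;> ring

theorem Rch.mulpos {V : Type*} {p e : V → ℝ} {τ : V → ℕ} {i : V} {s w : ℤ}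
    (h : Rch p e τ i i s w) (n : ℤ) (hn : 0 < n) : Rch p e τ i i (n * s) (n * w) := by
  have := h.pow (n - 1).toNat
  have h2 : (((n - 1).toNat : ℤ) + 1) = n := by omega
  rwa [h2] at this

section dyn
variable {V : Type*} {p e : V → ℝ} {τ : V → ℕ} {f H : ℝ → ℝ}

def QQ (p : V → ℝ) (τ : V → ℕ) (f H : ℝ → ℝ) (i j : V) (s w : ℤ) : Prop :=
  (s = 0 → ltL p τ j w i 0) ∧ (∀ n : ℕ, s = n → p j + w ≤ f^[n] (p i)) ∧
    (∀ n : ℕ, s = -n → p j + w ≤ H^[n] (p i))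

theorem ltL_le {i j : V} {a b : ℤ} (h : ltL p τ i a j b) : p i + a ≤ p j + b := by
  rcases h with h | h
  · exact h.le
  · exact h.1.le

theorem ltL_trans {i j k : V} {a b c : ℤ} (h : ltL p τ i a j b) (h' : ltL p τ j b k c) :
    ltL p τ i a k c := by
  unfold ltL at *
  rcases h with h | h <;> rcases h' with h' | h'
  · left; linarith
  · left; linarith [h'.1]
  · left; linarith [h.1]
  · right; exact ⟨h.1.trans h'.1, h.2.trans h'.2⟩

theorem ltL_shift {i j : V} {a b : ℤ} (c : ℤ) (h : ltL p τ i a j b) :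
    ltL p τ i (a + c) j (b + c) := by
  unfold ltL at *
  push_cast
  rcases h with h | h
  · left; linarith
  · right; exact ⟨by linarith [h.1], h.2⟩

theorem rch_QQ (hf : Monotone f) (hH : Monotone H) (fH : ∀ y, f (H y) < y) (Hf : ∀ y, H (f y) < y)
    (hfwd : ∀ (i j : V) (w a : ℤ), p j + w ≤ e i → p j + (a + w) ≤ f (p i + a))
    (hbwd : ∀ (i j : V) (w a : ℤ), e j + w < p i → p j + (a + w) ≤ H (p i + a))
    {i j : V} {s w : ℤ} (h : Rch p e τ i j s w) : QQ p τ f H i j s w := by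
  have key : ∀ (i j k : V) (s w s' w' : ℤ), (QQ p τ f H i j s w ∨ (i = j ∧ s = 0 ∧ w = 0)) →
      Stp p e τ j k s' w' → QQ p τ f H i k (s + s') (w + w') := by
    intro i j k s w s' w' hq hs
    have hq2 : ∀ n : ℕ, s = n → p j + w ≤ f^[n] (p i) := by
      rcases hq with hq | ⟨rfl, rfl, rfl⟩
      · exact hq.2.1
      · intro n hn
        have : n = 0 := by omega
        subst this; simp
    have hq3 : ∀ n : ℕ, s = -n → p j + w ≤ H^[n] (p i) := by
      rcases hq with hq | ⟨rfl, rfl, rfl⟩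
      · exact hq.2.2
      · intro n hn
        have : n = 0 := by omega
        subst this; simp
    cases hs with
    | fwd w' h =>
      have h1 := hfwd _ _ _ w h
      have h0 : s + 1 = 0 → p k + (w + w' : ℤ) < p i := by
        intro hs
        have := hq3 1 (by push_cast; omega)
        push_cast
        calc _ ≤ _ := h1
          _ ≤ _ := hf this
          _ < _ := fH _
      refine ⟨fun hs => Or.inl (by simpa using h0 hs), fun n hn => ?_, fun n hn => ?_⟩
      · rcases n with _ | n
        · exact (h0 (by simpa using hn)).le
        · rw [Function.iterate_succ_apply']
          push_cast at hn ⊢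
          exact h1.trans (hf (hq2 n (by omega)))
      · have := hq3 (n + 1) (by push_cast; omega)
        rw [Function.iterate_succ_apply'] at this
        push_cast
        exact (h1.trans (hf this)).trans (fH _).le
    | bwd w' h =>
      have h1 := hbwd _ _ _ w h
      have h0 : s + -1 = 0 → p k + (w + w' : ℤ) < p i := by
        intro hs
        have := hq2 1 (by push_cast; omega)
        push_cast
        calc _ ≤ _ := h1
          _ ≤ _ := hH this
          _ < _ := Hf _
      refine ⟨fun hs => Or.inl (by simpa using h0 hs), fun n hn => ?_, fun n hn => ?_⟩
      · have := hq2 (n + 1) (by push_cast; omega)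
        rw [Function.iterate_succ_apply'] at this
        push_cast
        exact (h1.trans (hH this)).trans (Hf _).le
      · rcases n with _ | n
        · exact (h0 (by simpa using hn)).le
        · rw [Function.iterate_succ_apply']
          push_cast at hn ⊢
          exact h1.trans (hH (hq3 n (by omega)))
    | dn w' h =>
      have h1 := ltL_shift w h
      have h2 := ltL_le h1
      rw [zero_add] at h1 h2
      rw [add_comm w' w] at h1 h2
      refine ⟨fun hs => ?_, fun n hn => ?_, fun n hn => ?_⟩
      · rcases hq with hq | ⟨rfl, rfl, rfl⟩
        · exact ltL_trans h1 (hq.1 (by omega))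
        · exact h1
      · exact h2.trans (hq2 n (by omega))
      · exact h2.trans (hq3 n (by omega))
  induction h with
  | single h =>
    have := key _ _ _ 0 0 _ _ (Or.inr ⟨rfl, rfl, rfl⟩) h
    simpa using this
  | snoc _ h ih => exact key _ _ _ _ _ _ _ (Or.inl ih) h

end dyn

section A
variable {V : Type*} [Fintype V] {p e : V → ℝ} {τ : V → ℕ}

/-- No closed walk with zero net number of jumps and nonnegative winding. -/
theorem noClosed (hm : ∀ (i k : V) (b : ℤ), p i ≤ p k + b → e i ≤ e k + b)
    {i : V} {w : ℤ} (h : Rch p e τ i i 0 w) : w < 0 := by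
  have hne : (Finset.univ : Finset V).Nonempty := ⟨i, Finset.mem_univ i⟩
  let f : ℝ → ℝ := fun x => Finset.univ.sup' hne (fun v => e v + ⌊x - p v⌋)
  let H : ℝ → ℝ := fun y => Finset.univ.sup' hne (fun v => p v + (⌈y - e v⌉ - 1))
  have hfex : ∀ x, ∃ v, ∃ a : ℤ, f x = e v + a ∧ p v + a ≤ x := by
    intro x
    obtain ⟨v, -, hv⟩ := Finset.exists_mem_eq_sup' hne (fun v => e v + (⌊x - p v⌋ : ℝ))
    exact ⟨v, _, hv, by linarith [Int.floor_le (x - p v)]⟩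
  have hHex : ∀ y, ∃ v, ∃ a : ℤ, H y = p v + a ∧ e v + a < y := by
    intro y
    obtain ⟨v, -, hv⟩ := Finset.exists_mem_eq_sup' hne (fun v => p v + ((⌈y - e v⌉ : ℝ) - 1))
    refine ⟨v, ⌈y - e v⌉ - 1, ?_, ?_⟩
    · push_cast; exact hv
    · push_cast; linarith [Int.ceil_lt_add_one (y - e v)]
  have hfle : ∀ x v (a : ℤ), p v + a ≤ x → e v + a ≤ f x := by
    intro x v a h
    have h1 : a ≤ ⌊x - p v⌋ := Int.le_floor.2 (by linarith)
    have h2 : (a : ℝ) ≤ ⌊x - p v⌋ := by exact_mod_cast h1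
    have h3 := Finset.le_sup' (fun v => e v + (⌊x - p v⌋ : ℝ)) (Finset.mem_univ v)
    exact le_trans (by linarith) h3
  have hHle : ∀ y v (a : ℤ), e v + a < y → p v + a ≤ H y := by
    intro y v a h
    have h1 : a < ⌈y - e v⌉ := Int.lt_ceil.2 (by linarith)
    have h2 : (a : ℝ) + 1 ≤ ⌈y - e v⌉ := by exact_mod_cast h1
    have h3 := Finset.le_sup' (fun v => p v + ((⌈y - e v⌉ : ℝ) - 1)) (Finset.mem_univ v)
    exact le_trans (by linarith) h3
  have hm' : ∀ (i k : V) (a b : ℤ), p i + a ≤ p k + b → e i + a ≤ e k + b := by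
    intro i k a b h
    have := hm i k (b - a) (by push_cast; linarith)
    push_cast at this; linarith
  have := rch_QQ (f := f) (H := H) (τ := τ) (p := p) (e := e) ?_ ?_ ?_ ?_ ?_ ?_ h
  · have h0 := this.1 rfl
    rcases h0 with h0 | h0
    · have : (w : ℝ) < 0 := by push_cast at h0; linarith
      exact_mod_cast this
    · exact absurd h0.2 (lt_irrefl _)
  · intro x y hxy
    obtain ⟨v, a, h1, h2⟩ := hfex x
    rw [h1]; exact hfle _ _ _ (h2.trans hxy)
  · intro x y hxy
    obtain ⟨v, a, h1, h2⟩ := hHex x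
    rw [h1]; exact hHle _ _ _ (h2.trans_le hxy)
  · intro y
    obtain ⟨k, m, h1, h2⟩ := hHex y
    obtain ⟨v, a, h3, h4⟩ := hfex (H y)
    rw [h3]
    rw [h1] at h4
    exact (hm' _ _ _ _ h4).trans_lt h2
  · intro y
    obtain ⟨v, a, h3, h4⟩ := hfex y
    obtain ⟨k, m, h1, h2⟩ := hHex (f y)
    rw [h1]
    rw [h3] at h2
    refine lt_of_lt_of_le ?_ h4
    by_contra hc
    exact absurd (hm' _ _ _ _ (not_lt.1 hc)) (not_le.2 h2)
  · intro i j w a h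
    have h1 := hfle (p i + a) i a le_rfl
    linarith
  · intro i j w a h
    have h1 := hHle (p i + a) j (a + w) (by push_cast; linarith)
    push_cast at h1; linarith

theorem exists_dn (i j : V) : ∃ w, Rch p e τ i j 0 w :=
  ⟨⌊p i - p j⌋ - 1, .single (.dn _ _ _ (Or.inl (by
    push_cast; linarith [Int.floor_le (p i - p j)])))⟩

theorem exists_c [Nonempty V] (hm : ∀ (i k : V) (b : ℤ), p i ≤ p k + b → e i ≤ e k + b) :
    ∃ c : ℝ, ∀ (i : V) (s w : ℤ), Rch p e τ i i s w → (w : ℝ) ≤ s * c := by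
  have cmp : ∀ (i j : V) (s w s' w' : ℤ), Rch p e τ i i s w → Rch p e τ j j s' w' → 0 < s → s' < 0 →
      s * w' ≤ s' * w := by
    intro i j s w s' w' h h' hs hs'
    by_contra hc
    obtain ⟨u, hu⟩ := exists_dn (p := p) (e := e) (τ := τ) i j
    obtain ⟨v, hv⟩ := exists_dn (p := p) (e := e) (τ := τ) j i
    let N : ℤ := |u + v| + 1
    have hN : 0 < N := by positivity
    have h1 := ((((h.mulpos (N * -s') (by apply mul_pos hN; omega)).trans hu).trans
      (h'.mulpos (N * s) (mul_pos hN hs))).trans hv)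
    have h2 : N * -s' * s + 0 + N * s * s' + 0 = 0 := by ring
    rw [h2] at h1
    have h3 := noClosed hm h1
    have h4 : N * 1 ≤ N * (s * w' - s' * w) := mul_le_mul_of_nonneg_left (by omega) hN.le
    have h5 := neg_abs_le (u + v)
    have h6 : N * -s' * w + u + N * s * w' + v = N * (s * w' - s' * w) + (u + v) := by ring
    rw [h6] at h3
    simp only [N] at *
    omega
  let A : Set ℝ := {x | ∃ (i : V) (s w : ℤ), Rch p e τ i i s w ∧ 0 < s ∧ x = w / s}
  let i0 : V := Classical.arbitrary V
  have hA : A.Nonempty := ⟨_, i0, 1, ⌊e i0 - p i0⌋, .single (.fwd _ _ _ (by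
    linarith [Int.floor_le (e i0 - p i0)])), one_pos, rfl⟩
  have hB : ∀ x ∈ A, ∀ (j : V) (s' w' : ℤ), Rch p e τ j j s' w' → s' < 0 → x ≤ w' / s' := by
    rintro x ⟨i, s, w, h, hs, rfl⟩ j s' w' h' hs'
    have h1 := cmp i j s w s' w' h h' hs hs'
    have h1' : (s : ℝ) * w' ≤ s' * w := by exact_mod_cast h1
    have hsr : (0 : ℝ) < s := by exact_mod_cast hs
    have hsr' : (s' : ℝ) < 0 := by exact_mod_cast hs'
    rw [div_le_iff₀ hsr, div_mul_eq_mul_div, le_div_iff_of_neg hsr']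
    linarith
  have hbd : BddAbove A := by
    refine ⟨_, fun x hx => hB x hx i0 (-1) (⌊p i0 - e i0⌋ - 1) (.single (.bwd _ _ _ ?_)) (by omega)⟩
    push_cast
    linarith [Int.floor_le (p i0 - e i0)]
  refine ⟨sSup A, fun i s w h => ?_⟩
  rcases lt_trichotomy s 0 with hs | hs | hs
  · have hsr : (s : ℝ) < 0 := by exact_mod_cast hs
    have := csSup_le hA (fun x hx => hB x hx i s w h hs)
    rw [le_div_iff_of_neg hsr] at this
    linarith
  · subst hs
    have := noClosed hm h
    have : (w : ℝ) < 0 := by exact_mod_cast this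
    simpa using this.le
  · have hsr : (0 : ℝ) < s := by exact_mod_cast hs
    have := le_csSup hbd (show (w : ℝ) / s ∈ A from ⟨i, s, w, h, hs, rfl⟩)
    rw [div_le_iff₀ hsr] at this
    linarith

end A

section B
variable {V : Type*} [Fintype V]

/-- The winding number of the next lift of `j` after `i`. -/
noncomputable def wnd (p : V → ℝ) (τ : V → ℕ) (i j : V) : ℤ :=
  if τ i < τ j then ⌈p i - p j⌉ else ⌊p i - p j⌋ + 1

theorem wnd_lt (p : V → ℝ) (τ : V → ℕ) (i j : V) : ltL p τ i 0 j (wnd p τ i j) := by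
  unfold wnd ltL
  split_ifs with h
  · rcases (Int.le_ceil (p i - p j)).lt_or_eq with h' | h'
    · left; push_cast; linarith
    · right; exact ⟨by push_cast; linarith, h⟩
  · left; push_cast; linarith [Int.lt_floor_add_one (p i - p j)]

theorem wnd_min (p : V → ℝ) (τ : V → ℕ) (i j : V) (m : ℤ) (h : ltL p τ i 0 j m) :
    wnd p τ i j ≤ m := by
  unfold wnd
  unfold ltL at h
  push_cast at h
  split_ifs with h'
  · apply Int.ceil_le.2
    rcases h with h | h
    · linarith
    · linarith [h.1]
  · have h2 := h.resolve_right (fun h => h' h.2)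
    have : ⌊p i - p j⌋ < m := Int.floor_lt.2 (by linarith)
    omega

theorem wnd_add (p : V → ℝ) (τ : V → ℕ) (hτ : Function.Injective τ) (i j : V) (hij : i ≠ j) :
    wnd p τ i j + wnd p τ j i = 1 := by
  have hne : τ i ≠ τ j := fun h => hij (hτ h)
  have e1 : p j - p i = -(p i - p j) := by ring
  have e2 : p i - p j = -(p j - p i) := by ring
  unfold wnd
  rcases lt_or_gt_of_ne hne with h | h
  · rw [if_pos h, if_neg (by omega), e1, Int.floor_neg]; omega
  · rw [if_neg (by omega), if_pos h, e1, Int.ceil_neg]; omega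

theorem lex_to_real (S : Finset (ℝ ×ₗ ℝ)) (hS : ∀ z ∈ S, 0 < z) :
    ∃ η : ℝ, 0 < η ∧ ∀ z ∈ S, 0 < (ofLex z).1 + η * (ofLex z).2 := by
  have h : ∀ z ∈ S, ∀ᶠ η : ℝ in nhdsWithin 0 (Set.Ioi 0), 0 < (ofLex z).1 + η * (ofLex z).2 := by
    intro z hz
    have h0 := hS z hz
    rw [Prod.Lex.lt_iff] at h0
    rcases h0 with h0 | h0
    · have hc : Continuous (fun η : ℝ => (ofLex z).1 + η * (ofLex z).2) := by fun_prop
      have : ∀ᶠ η : ℝ in nhds 0, 0 < (ofLex z).1 + η * (ofLex z).2 :=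
        hc.continuousAt.eventually (lt_mem_nhds (by simpa using h0))
      exact this.filter_mono nhdsWithin_le_nhds
    · filter_upwards [self_mem_nhdsWithin] with η hη
      have h1 : (ofLex z).1 = 0 := h0.1.symm
      have h2 : 0 < (ofLex z).2 := h0.2
      rw [h1, zero_add]
      exact mul_pos hη h2
  have h2 := (Finset.eventually_all S).2 h
  obtain ⟨η, h3, h4⟩ := (h2.and self_mem_nhdsWithin).exists
  exact ⟨η, h4, h3⟩

theorem core [Nonempty V] (p e : V → ℝ) (τ : V → ℕ) 
    (hm : ∀ (i k : V) (b : ℤ), p i ≤ p k + b → e i ≤ e k + b) :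
    ∃ x r : V → ℝ, ∀ i j : V, x i < x j + wnd p τ i j ∧
      (p j + wnd p τ i j ≤ e i → x j + wnd p τ i j - x i < r i ∧ x j + wnd p τ i j - x i < r j) ∧
      (e i < p j + wnd p τ i j → r i < x j + wnd p τ i j - x i ∧ r j < x j + wnd p τ i j - x i) := by
  classical
  obtain ⟨c, hc⟩ := exists_c (τ := τ) hm
  let Plus : V → Prop := fun i => ∃ s w : ℤ, 0 < s ∧ Rch p e τ i i s w ∧ (w : ℝ) = s * c
  let σ : V → ℝ := fun i => if Plus i then 1 else -1
  have hσ1 : ∀ i, Plus i → σ i = 1 := fun i h => if_pos h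
  have hσ2 : ∀ i, ¬ Plus i → σ i = -1 := fun i h => if_neg h
  have hσ3 : ∀ i, -1 ≤ σ i ∧ σ i ≤ 1 := by
    intro i
    by_cases h : Plus i
    · rw [hσ1 i h]; norm_num
    · rw [hσ2 i h]; norm_num
  have hneg : ∀ i (s w : ℤ), s < 0 → Rch p e τ i i s w → (w : ℝ) = s * c → ¬ Plus i := by
    rintro i s w hs h hw ⟨s', w', hs', h', hw'⟩
    have h1 := (h.mulpos s' hs').trans (h'.mulpos (-s) (by omega))
    have h2 : s' * s + -s * s' = 0 := by ring
    rw [h2] at h1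
    have h3 := noClosed hm h1
    have h4 : ((s' * w + -s * w' : ℤ) : ℝ) = 0 := by
      push_cast; rw [hw, hw']; ring
    have h5 : s' * w + -s * w' = 0 := by exact_mod_cast h4
    omega
  let RR : V → V → ℤ → ℤ → Prop := fun i j s w => Rch p e τ i j s w ∨ (i = j ∧ s = 0 ∧ w = 0)
  have hRR : ∀ i j k s w s' w', Rch p e τ i j s w → RR j k s' w' →
      Rch p e τ i k (s + s') (w + w') := by
    rintro i j k s w s' w' h (h' | ⟨rfl, rfl, rfl⟩)
    · exact h.trans h'
    · simpa using h
  have hRR' : ∀ i j k s w s' w', RR i j s w → Rch p e τ j k s' w' →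
      Rch p e τ i k (s + s') (w + w') := by
    rintro i j k s w s' w' (h' | ⟨rfl, rfl, rfl⟩) h
    · exact h'.trans h
    · simpa using h
  let P : V → V → (ℝ ×ₗ ℝ) → Prop := fun i j α => ∃ (s w : ℤ) (L : ℝ),
    α = toLex (s * c - w, L) ∧ Rch p e τ i j s w ∧
      ∀ s' w' : ℤ, RR j i s' w' → ((s + s' : ℤ) : ℝ) * c = ((w + w' : ℤ) : ℝ) →
        (0 < s + s' → (s : ℝ) ≤ L) ∧ (s + s' < 0 → -(s : ℝ) ≤ L)
  have htr : ∀ i j k a b, P i j a → P j k b → P i k (a + b) := by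
    rintro i j k a b ⟨s1, w1, L1, rfl, h1, q1⟩ ⟨s2, w2, L2, rfl, h2, q2⟩
    refine ⟨s1 + s2, w1 + w2, L1 + L2, ?_, h1.trans h2, ?_⟩
    · rw [← toLex_add, Prod.mk_add_mk]
      congr 2
      push_cast; ring
    · intro s' w' hr hz
      have a1 := q1 (s2 + s') (w2 + w') (Or.inl (hRR _ _ _ _ _ _ _ h2 hr))
        (by rw [← add_assoc, ← add_assoc]; exact hz)
      have a2 := q2 (s' + s1) (w' + w1) (Or.inl (hRR' _ _ _ _ _ _ _ hr h1))
        (by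
          rw [show s2 + (s' + s1) = s1 + s2 + s' by ring,
            show w2 + (w' + w1) = w1 + w2 + w' by ring]; exact hz)
      push_cast
      refine ⟨fun h => ?_, fun h => ?_⟩
      · have b1 := a1.1 (by omega)
        have b2 := a2.1 (by omega)
        linarith
      · have b1 := a1.2 (by omega)
        have b2 := a2.2 (by omega)
        linarith
  have hpos : ∀ i a, P i i a → 0 < a := by
    rintro i a ⟨s, w, L, rfl, h, q⟩
    have h1 := hc i s w h
    rw [Prod.Lex.lt_iff]
    rcases h1.lt_or_eq with h1 | h1
    · left
      change (0 : ℝ) < s * c - w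
      linarith
    · right
      refine ⟨?_, ?_⟩
      · change (0 : ℝ) = s * c - w
        linarith
      · change 0 < L
        have q' := q 0 0 (Or.inr ⟨rfl, rfl, rfl⟩) (by simpa using h1.symm)
        simp only [add_zero] at q'
        rcases lt_trichotomy s 0 with hs | hs | hs
        · have := q'.2 hs
          have hsr : (s : ℝ) < 0 := by exact_mod_cast hs
          linarith
        · subst hs
          have h2 := noClosed hm h
          have h3 : (w : ℝ) < 0 := by exact_mod_cast h2
          simp at h1
          rw [h1] at h2; exact absurd h2 (lt_irrefl _)
        · have := q'.1 hs
          have hsr : (0 : ℝ) < s := by exact_mod_cast hs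
          linarith
  have Pfwd : ∀ i j k (w : ℤ), p j + w ≤ e i → (k = i ∨ k = j) → P i j (toLex (c - w, σ k)) := by
    intro i j k w h hk
    refine ⟨1, w, σ k, by simp, .single (.fwd _ _ _ h), fun s' w' hr hz => ⟨fun hs => ?_, fun hs => ?_⟩⟩
    · have hP : Plus k := by
        rcases hk with rfl | rfl
        · exact ⟨_, _, hs, hRR _ _ _ _ _ _ _ (.single (.fwd _ _ _ h)) hr, hz.symm⟩
        · refine ⟨s' + 1, w' + w, by omega, hRR' _ _ _ _ _ _ _ hr (.single (.fwd _ _ _ h)), ?_⟩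
          rw [add_comm s', add_comm w']; exact hz.symm
      rw [hσ1 k hP]; simp
    · have := (hσ3 k).1
      simpa using this
  have Pbwd : ∀ i j k (w : ℤ), e i < p j + w → (k = i ∨ k = j) →
      P j i (toLex (w - c, -σ k)) := by
    intro i j k w h hk
    have hst : Rch p e τ j i (-1) (-w) := .single (.bwd _ _ _ (by push_cast; linarith))
    refine ⟨-1, -w, -σ k, ?_, hst, fun s' w' hr hz => ⟨fun hs => ?_, fun hs => ?_⟩⟩
    · congr 2; push_cast; ring
    · have := (hσ3 k).2
      simpa using this
    · have hP : ¬ Plus k := by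
        rcases hk with rfl | rfl
        · refine hneg _ (s' + -1) (w' + -w) (by omega) (hRR' _ _ _ _ _ _ _ hr hst) ?_
          rw [add_comm s', add_comm w']; exact hz.symm
        · exact hneg _ _ _ hs (hRR _ _ _ _ _ _ _ hst hr) hz.symm
      rw [hσ2 k hP]; simp
  have Pdn : ∀ i j (w : ℤ), ltL p τ i 0 j w → P j i (toLex ((w : ℝ), 0)) := by
    intro i j w h
    have h' := ltL_shift (-w) h
    rw [zero_add, add_neg_cancel] at h'
    refine ⟨0, -w, 0, ?_, .single (.dn _ _ _ h'), fun s' w' hr hz => ⟨fun hs => ?_, fun hs => ?_⟩⟩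
    · congr 2; push_cast; ring
    · simp
    · simp
  let W := wnd p τ
  let E : Finset (V × V × (ℝ ×ₗ ℝ)) :=
    (Finset.univ.image (fun q : V × V => (q.2, q.1, toLex ((W q.1 q.2 : ℝ), (0 : ℝ))))) ∪
    ((Finset.univ.filter (fun q : V × V => p q.2 + W q.1 q.2 ≤ e q.1)).image
      (fun q : V × V => (q.1, q.2, toLex (c - W q.1 q.2, σ q.1)))) ∪
    ((Finset.univ.filter (fun q : V × V => p q.2 + W q.1 q.2 ≤ e q.1)).image
      (fun q : V × V => (q.1, q.2, toLex (c - W q.1 q.2, σ q.2)))) ∪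
    ((Finset.univ.filter (fun q : V × V => e q.1 < p q.2 + W q.1 q.2)).image
      (fun q : V × V => (q.2, q.1, toLex (W q.1 q.2 - c, -σ q.1)))) ∪
    ((Finset.univ.filter (fun q : V × V => e q.1 < p q.2 + W q.1 q.2)).image
      (fun q : V × V => (q.2, q.1, toLex (W q.1 q.2 - c, -σ q.2))))
  obtain ⟨X, hX⟩ := fm P htr hpos Finset.univ E (by
    intro z hz
    refine ⟨?_, Finset.mem_univ _, Finset.mem_univ _⟩
    simp only [E, Finset.mem_union, Finset.mem_image, Finset.mem_filter, Finset.mem_univ,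
      true_and] at hz
    rcases hz with (((⟨q, rfl⟩ | ⟨q, h, rfl⟩) | ⟨q, h, rfl⟩) | ⟨q, h, rfl⟩) | ⟨q, h, rfl⟩
    · exact Pdn _ _ _ (wnd_lt _ _ _ _)
    · exact Pfwd _ _ _ _ h (Or.inl rfl)
    · exact Pfwd _ _ _ _ h (Or.inr rfl)
    · exact Pbwd _ _ _ _ h (Or.inl rfl)
    · exact Pbwd _ _ _ _ h (Or.inr rfl))
  obtain ⟨η, hη, hη'⟩ := lex_to_real (E.image (fun z => z.2.2 - (X z.2.1 - X z.1))) (by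
    intro y hy
    obtain ⟨z, hz, rfl⟩ := Finset.mem_image.1 hy
    exact sub_pos.2 (hX z hz))
  have hfin : ∀ (i j : V) (a b : ℝ), (i, j, toLex (a, b)) ∈ E →
      0 < (a - ((ofLex (X j)).1 - (ofLex (X i)).1)) +
        η * (b - ((ofLex (X j)).2 - (ofLex (X i)).2)) := by
    intro i j a b h
    exact hη' _ (Finset.mem_image_of_mem _ h)
  refine ⟨fun i => (ofLex (X i)).1 + η * (ofLex (X i)).2, fun i => c + η * σ i, fun i j => ⟨?_, ?_, ?_⟩⟩
  · have := hfin j i (W i j) 0 (by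
      simp only [E, Finset.mem_union]
      exact Or.inl (Or.inl (Or.inl (Or.inl (Finset.mem_image.2 ⟨(i, j), Finset.mem_univ _, rfl⟩)))))
    simp only [W] at this
    linarith
  · intro h
    have h1 := hfin i j (c - W i j) (σ i) (by
      simp only [E, Finset.mem_union]
      exact Or.inl (Or.inl (Or.inl (Or.inr (Finset.mem_image.2
        ⟨(i, j), Finset.mem_filter.2 ⟨Finset.mem_univ _, h⟩, rfl⟩)))))
    have h2 := hfin i j (c - W i j) (σ j) (by
      simp only [E, Finset.mem_union]
      exact Or.inl (Or.inl (Or.inr (Finset.mem_image.2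
        ⟨(i, j), Finset.mem_filter.2 ⟨Finset.mem_univ _, h⟩, rfl⟩))))
    simp only [W] at h1 h2
    constructor <;> linarith
  · intro h
    have h1 := hfin j i (W i j - c) (-σ i) (by
      simp only [E, Finset.mem_union]
      exact Or.inl (Or.inr (Finset.mem_image.2
        ⟨(i, j), Finset.mem_filter.2 ⟨Finset.mem_univ _, h⟩, rfl⟩)))
    have h2 := hfin j i (W i j - c) (-σ j) (by
      simp only [E, Finset.mem_union]
      exact Or.inr (Finset.mem_image.2
        ⟨(i, j), Finset.mem_filter.2 ⟨Finset.mem_univ _, h⟩, rfl⟩))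
    simp only [W] at h1 h2
    constructor <;> linarith

end B

section C

theorem two_pi_pos' : (0 : ℝ) < 2 * π := by positivity

theorem cmod_spec (x : ℝ) : ∃ m : ℤ, x = cmod x + 2 * π * m :=
  ⟨⌊x / (2 * π)⌋, by unfold cmod; ring⟩

theorem cmod_eq (x : ℝ) : cmod x = 2 * π * Int.fract (x / (2 * π)) := by
  unfold cmod Int.fract
  field_simp

theorem cmod_nonneg (x : ℝ) : 0 ≤ cmod x := by
  rw [cmod_eq]; exact mul_nonneg two_pi_pos'.le (Int.fract_nonneg _)

theorem cmod_lt (x : ℝ) : cmod x < 2 * π := by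
  rw [cmod_eq]
  have := mul_lt_mul_of_pos_left (Int.fract_lt_one (x / (2 * π))) two_pi_pos'
  linarith

theorem cmod_unique {x y : ℝ} (h0 : 0 ≤ y) (h1 : y < 2 * π) (m : ℤ) (h : x = y + 2 * π * m) :
    cmod x = y := by
  have : x / (2 * π) = y / (2 * π) + m := by rw [h]; field_simp
  rw [cmod_eq, this, Int.fract_add_intCast, Int.fract_eq_self.2]
  · field_simp
  · exact ⟨by positivity, by rw [div_lt_one two_pi_pos']; exact h1⟩

theorem cmod_cmod_sub (a b : ℝ) : cmod (cmod a - b) = cmod (a - b) := by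
  obtain ⟨m, hm⟩ := cmod_spec a
  obtain ⟨n, hn⟩ := cmod_spec (a - b)
  refine cmod_unique (cmod_nonneg _) (cmod_lt _) (n - m) ?_
  push_cast
  linarith

theorem cmod_le_iff {x s ℓ : ℝ} (h1 : ℓ < 2 * π) :
    cmod (x - s) ≤ ℓ ↔ ∃ m : ℤ, s ≤ x + 2 * π * m ∧ x + 2 * π * m ≤ s + ℓ := by
  constructor
  · intro h
    obtain ⟨m, hm⟩ := cmod_spec (x - s)
    have := cmod_nonneg (x - s)
    exact ⟨-m, by push_cast; linarith, by push_cast; linarith⟩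
  · rintro ⟨m, h2, h3⟩
    have := cmod_unique (x := x - s) (y := x + 2 * π * m - s) (by linarith) (by linarith) (-m)
      (by push_cast; ring)
    linarith

theorem arc_inter {s ℓ s' ℓ' : ℝ} (h0 : 0 < ℓ) (h1 : ℓ < 2 * π) (h0' : 0 < ℓ') (h1' : ℓ' < 2 * π) :
    (arcC s ℓ ∩ arcC s' ℓ').Nonempty ↔ cmod (s' - s) ≤ ℓ ∨ cmod (s - s') ≤ ℓ' := by
  have hz : ∀ a, cmod (a - a) = 0 := fun a =>
    cmod_unique le_rfl two_pi_pos' 0 (by simp)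
  constructor
  · rintro ⟨y, ⟨hy, h⟩, ⟨-, h'⟩⟩
    rw [cmod_le_iff h1] at h
    rw [cmod_le_iff h1'] at h'
    rw [cmod_le_iff h1, cmod_le_iff h1']
    obtain ⟨m, a1, a2⟩ := h
    obtain ⟨n, b1, b2⟩ := h'
    rcases le_total (s - 2 * π * m) (s' - 2 * π * n) with h | h
    · left; exact ⟨m - n, by push_cast; linarith, by push_cast; linarith⟩
    · right; exact ⟨n - m, by push_cast; linarith, by push_cast; linarith⟩
  · rintro (h | h)
    · refine ⟨cmod s', ⟨⟨cmod_nonneg _, cmod_lt _⟩, ?_⟩, ⟨⟨cmod_nonneg _, cmod_lt _⟩, ?_⟩⟩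
      · rw [cmod_cmod_sub]; exact h
      · rw [cmod_cmod_sub, hz]; exact h0'.le
    · refine ⟨cmod s, ⟨⟨cmod_nonneg _, cmod_lt _⟩, ?_⟩, ⟨⟨cmod_nonneg _, cmod_lt _⟩, ?_⟩⟩
      · rw [cmod_cmod_sub, hz]; exact h0.le
      · rw [cmod_cmod_sub]; exact h

theorem backward {V : Type*} [Fintype V] (G : SignedGraph V)
    (h : IsProperCircularArcGraph G.pos) : ∃ D : V → ℝ, IsValidDrawing G D := by
  have hT := two_pi_pos'
  obtain ⟨A, ⟨hA, hadj⟩, hprop⟩ := h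
  rcases isEmpty_or_nonempty V with hV | hV
  · exact ⟨fun _ => 0, ⟨fun i => (IsEmpty.false i).elim, fun i => (IsEmpty.false i).elim⟩,
      fun i => (IsEmpty.false i).elim⟩
  choose s ℓ hℓ0 hℓ1 hAe using hA
  let p : V → ℝ := fun v => s v / (2 * π)
  let e : V → ℝ := fun v => (s v + ℓ v) / (2 * π)
  have hp : ∀ v, s v = 2 * π * p v := fun v => by simp only [p]; field_simp
  have he : ∀ v, s v + ℓ v = 2 * π * e v := fun v => by simp only [e]; field_simp
  have hpe : ∀ v, p v ≤ e v := fun v => by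
    have h1 := hp v; have h2 := he v
    have : 2 * π * p v ≤ 2 * π * e v := by linarith [hℓ0 v]
    exact le_of_mul_le_mul_left this hT
  have hm : ∀ (i k : V) (b : ℤ), p i ≤ p k + b → e i ≤ e k + b := by
    intro i k b hik
    by_contra hc
    rw [not_le] at hc
    have h1 : 2 * π * p i ≤ 2 * π * (p k + b) := mul_le_mul_of_nonneg_left hik hT.le
    have h2 : 2 * π * (e k + b) < 2 * π * e i := mul_lt_mul_of_pos_left hc hT
    rw [mul_add] at h1 h2
    rw [← hp, ← hp] at h1
    rw [← he, ← he] at h2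
    apply hprop k i
    rw [hAe, hAe]
    refine ⟨?_, ?_⟩
    · rintro y ⟨hy, hy2⟩
      refine ⟨hy, ?_⟩
      rw [cmod_le_iff (hℓ1 _)] at hy2 ⊢
      obtain ⟨m, a1, a2⟩ := hy2
      exact ⟨m + b, by push_cast; linarith, by push_cast; linarith⟩
    · intro hsub
      have hmem : cmod (s i + ℓ i) ∈ arcC (s i) (ℓ i) := by
        refine ⟨⟨cmod_nonneg _, cmod_lt _⟩, ?_⟩
        rw [cmod_cmod_sub, cmod_le_iff (hℓ1 _)]
        exact ⟨0, by simp [(hℓ0 i).le], by simp⟩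
      have h3 := (hsub hmem).2
      rw [cmod_cmod_sub] at h3
      have h4 : cmod (s i + ℓ i - s k) = s i + ℓ i - s k - 2 * π * b :=
        cmod_unique (by linarith [hℓ0 k]) (by linarith [hℓ1 i]) b (by ring)
      rw [h4] at h3
      linarith
  let τ : V → ℕ := fun v => (Fintype.equivFin V v : ℕ)
  have hτ : Function.Injective τ := fun a b hab =>
    (Fintype.equivFin V).injective (Fin.ext hab)
  obtain ⟨x, r, hxr⟩ := core p e τ hm
  have hadj' : ∀ i j, i ≠ j → (G.pos.Adj i j ↔
      (p j + wnd p τ i j ≤ e i ∨ p i + wnd p τ j i ≤ e j)) := by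
    have one : ∀ i j, cmod (s j - s i) ≤ ℓ i ↔ ∃ m : ℤ, p i ≤ p j + m ∧ p j + m ≤ e i := by
      intro i j
      rw [cmod_le_iff (hℓ1 i)]
      refine exists_congr fun m => ?_
      rw [he, hp i, hp j, ← mul_add, mul_le_mul_iff_right₀ hT, mul_le_mul_iff_right₀ hT]
    have fw : ∀ i j, i ≠ j → cmod (s j - s i) ≤ ℓ i →
        (p j + wnd p τ i j ≤ e i ∨ p i + wnd p τ j i ≤ e j) := by
      intro i j hij h
      obtain ⟨m, h1, h2⟩ := (one i j).1 h
      have mn : ∀ a b (m : ℤ), ltL p τ a 0 b m → p b + wnd p τ a b ≤ p b + m := by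
        intro a b m h
        have : (wnd p τ a b : ℝ) ≤ m := by exact_mod_cast wnd_min _ _ _ _ _ h
        linarith
      by_cases hl : ltL p τ i 0 j m
      · left; exact (mn _ _ _ hl).trans h2
      · have heq : p i = p j + m := by
          by_contra hne
          exact hl (Or.inl (by simpa using lt_of_le_of_ne h1 hne))
        right
        have hτij : τ i ≠ τ j := fun h => hij (hτ h)
        have hlt : τ j < τ i := by
          rcases lt_or_gt_of_ne hτij with h | h
          · exact absurd (Or.inr ⟨by simpa using heq, h⟩) hl
          · exact h
        have h3 : ltL p τ j 0 i (-m) := Or.inr ⟨by push_cast; linarith, hlt⟩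
        refine (mn _ _ _ h3).trans ?_
        push_cast
        linarith [hpe j]
    have bw : ∀ i j, p j + wnd p τ i j ≤ e i → cmod (s j - s i) ≤ ℓ i := by
      intro i j h
      exact (one i j).2 ⟨_, by simpa using ltL_le (wnd_lt p τ i j), h⟩
    intro i j hij
    rw [hadj i j hij, hAe, hAe, arc_inter (hℓ0 _) (hℓ1 _) (hℓ0 _) (hℓ1 _)]
    constructor
    · rintro (h | h)
      · exact fw _ _ hij h
      · exact (fw _ _ hij.symm h).symm
    · rintro (h | h)
      · exact Or.inl (bw _ _ h)
      · exact Or.inr (bw _ _ h)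
  have hup : ∀ i j, i ≠ j → x j + wnd p τ i j < x i + 1 := by
    intro i j hij
    have h1 := (hxr j i).1
    have h2 : (wnd p τ i j : ℝ) + wnd p τ j i = 1 := by
      exact_mod_cast wnd_add p τ hτ i j hij
    linarith
  let D : V → ℝ := fun v => cmod (2 * π * x v)
  have hD : ∀ i j, i ≠ j → cmod (D j - D i) = 2 * π * (x j + wnd p τ i j - x i) := by
    intro i j hij
    obtain ⟨m, hm⟩ := cmod_spec (2 * π * x i)
    obtain ⟨n, hn⟩ := cmod_spec (2 * π * x j)
    have h1 := (hxr i j).1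
    have h2 := hup i j hij
    refine cmod_unique (mul_nonneg hT.le (by linarith)) ?_ (m - n - wnd p τ i j) ?_
    · have := mul_lt_mul_of_pos_left (show x j + wnd p τ i j - x i < 1 by linarith) hT
      linarith
    · push_cast
      simp only [D]
      linarith
  refine ⟨D, ⟨?_, fun v => ⟨cmod_nonneg _, cmod_lt _⟩⟩, ?_⟩
  · intro i j hij
    by_contra hne
    have h1 := hD i j hne
    have h2 : cmod (D j - D i) = 0 :=
      cmod_unique le_rfl hT 0 (by rw [hij]; simp)
    rw [h2] at h1
    have h3 := (hxr i j).1
    have := mul_pos hT (show 0 < x j + wnd p τ i j - x i by linarith)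
    linarith
  · intro i j k hj hk
    have hij : i ≠ j := hj.ne
    have hik : i ≠ k := hk.ne
    have hnk : ¬ G.pos.Adj i k := fun h => G.disjoint i k ⟨h, hk⟩
    rw [hadj' i j hij] at hj
    rw [hadj' i k hik, not_or, not_le, not_le] at hnk
    have a1 : cdist (D i) (D j) < 2 * π * r i := by
      unfold cdist
      rcases hj with hj | hj
      · refine lt_of_le_of_lt (min_le_right _ _) ?_
        rw [hD i j hij]
        exact mul_lt_mul_of_pos_left ((hxr i j).2.1 hj).1 hT
      · refine lt_of_le_of_lt (min_le_left _ _) ?_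
        rw [hD j i hij.symm]
        exact mul_lt_mul_of_pos_left ((hxr j i).2.1 hj).2 hT
    refine a1.trans ?_
    unfold cdist
    refine lt_min ?_ ?_
    · rw [hD k i hik.symm]
      exact mul_lt_mul_of_pos_left ((hxr k i).2.2 hnk.2).2 hT
    · rw [hD i k hik]
      exact mul_lt_mul_of_pos_left ((hxr i k).2.2 hnk.1).1 hT

theorem forward {V : Type*} [Fintype V] (G : SignedGraph V)
    (hcomplete : ∀ i j : V, i ≠ j → G.pos.Adj i j ∨ G.neg.Adj i j)
    (D : V → ℝ) (hD : IsValidDrawing G D) : IsProperCircularArcGraph G.pos := by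
  classical
  have hT := two_pi_pos'
  have hpi := Real.pi_pos
  obtain ⟨⟨hinj, hIco⟩, hval⟩ := hD
  let cm : V → V → ℝ := fun i j => cmod (D j - D i)
  have cm0 : ∀ i, cm i i = 0 := fun i => cmod_unique le_rfl hT 0 (by simp)
  have cmnn : ∀ i j, 0 ≤ cm i j := fun i j => cmod_nonneg _
  have cmadd : ∀ i j, i ≠ j → cm i j + cm j i = 2 * π := by
    have aux : ∀ i j, D i < D j → cm i j + cm j i = 2 * π := by
      intro i j h
      have h1 := (hIco i).1
      have h2 := (hIco j).2
      have e1 : cm i j = D j - D i := cmod_unique (by linarith) (by linarith) 0 (by simp)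
      have e2 : cm j i = D i - D j + 2 * π :=
        cmod_unique (by linarith) (by linarith) (-1) (by push_cast; ring)
      rw [e1, e2]; ring
    intro i j hij
    rcases lt_or_gt_of_ne (fun h => hij (hinj h) : D i ≠ D j) with h | h
    · exact aux _ _ h
    · rw [add_comm]; exact aux _ _ h
  have cmlt : ∀ i j, cm i j < 2 * π := fun i j => cmod_lt _
  have cmpos : ∀ i j, i ≠ j → 0 < cm i j := fun i j h => by
    linarith [cmadd i j h, cmlt j i]
  have cdeq : ∀ i j, cdist (D i) (D j) = min (cm j i) (cm i j) := fun i j => rfl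
  have cdeq' : ∀ i j, i ≠ j → cm i j ≤ π → cdist (D i) (D j) = cm i j := by
    intro i j hij h
    rw [cdeq, min_eq_right]; linarith [cmadd i j hij]
  have cdsymm : ∀ i j, cdist (D i) (D j) = cdist (D j) (D i) := by
    intro i j; rw [cdeq, cdeq, min_comm]
  have hJ : ∀ i, ∃ j, (j = i ∨ (G.pos.Adj i j ∧ cm i j ≤ π)) ∧
      ∀ k, (k = i ∨ (G.pos.Adj i k ∧ cm i k ≤ π)) → cm i k ≤ cm i j := by
    intro i
    obtain ⟨j, hj, hj2⟩ := Finset.exists_max_image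
      (Finset.univ.filter (fun j => j = i ∨ (G.pos.Adj i j ∧ cm i j ≤ π))) (cm i)
      ⟨i, by simp⟩
    refine ⟨j, (Finset.mem_filter.1 hj).2, fun k hk => hj2 k ?_⟩
    exact Finset.mem_filter.2 ⟨Finset.mem_univ _, hk⟩
  choose J hJ1 hJ2 using hJ
  let ρ : V → ℝ := fun i => cm i (J i)
  have ρ0 : ∀ i, 0 ≤ ρ i := fun i => cmnn _ _
  have ρπ : ∀ i, ρ i ≤ π := by
    intro i
    rcases hJ1 i with h | h
    · simp only [ρ]; rw [h, cm0]; exact hpi.le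
    · exact h.2
  have F1 : ∀ i k, i ≠ k → cm i k ≤ ρ i → G.pos.Adj i k := by
    intro i k hik h
    rcases hcomplete i k hik with h1 | h1
    · exact h1
    · exfalso
      rcases hJ1 i with h2 | h2
      · simp only [ρ] at h; rw [h2, cm0] at h
        linarith [cmpos i k hik]
      · have h3 := hval i (J i) k h2.1 h1
        rw [cdeq' i (J i) h2.1.ne h2.2] at h3
        have h4 : cdist (D i) (D k) ≤ cm i k := by rw [cdeq]; exact min_le_right _ _
        simp only [ρ] at h
        linarith
  have F2 : ∀ i k, G.pos.Adj i k → cm i k ≤ ρ i ∨ cm k i ≤ ρ k := by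
    intro i k h
    by_cases h1 : cm i k ≤ π
    · left; exact hJ2 i k (Or.inr ⟨h, h1⟩)
    · right; exact hJ2 k i (Or.inr ⟨h.symm, by linarith [cmadd i k h.ne]⟩)
  have F3 : ∀ i j, i ≠ j → cm j i ≤ ρ j → ρ j - cm j i ≤ ρ i := by
    intro i j hij h
    by_cases hi : J j = i
    · simp only [ρ] at *; rw [hi]; simpa using cmnn i (J i)
    rcases hJ1 j with h2 | h2
    · exfalso
      simp only [ρ] at h; rw [h2, cm0] at h
      linarith [cmpos j i hij.symm]
    · have e1 : cm i (J j) = ρ j - cm j i := by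
        obtain ⟨m, hm⟩ := cmod_spec (D (J j) - D j)
        obtain ⟨n, hn⟩ := cmod_spec (D i - D j)
        refine cmod_unique (by linarith) (by linarith [ρπ j, cmnn j i]) (m - n) ?_
        push_cast
        simp only [ρ, cm]
        linarith
      have e2 : cm i (J j) ≤ π := by linarith [ρπ j, cmnn j i]
      rw [← e1]
      apply hJ2
      right
      refine ⟨?_, e2⟩
      rcases hcomplete i (J j) (Ne.symm hi) with h1 | h1
      · exact h1
      · exfalso
        have h3 := hval (J j) j i h2.1.symm h1.symm
        rw [cdsymm, cdsymm _ i, cdeq' j _ h2.1.ne h2.2, cdeq' i _ (Ne.symm hi) e2, e1] at h3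
        simp only [ρ] at h3
        linarith [cmnn j i]
  obtain ⟨ε, hε, hε'⟩ := lex_to_real
    (insert (toLex (1, -1)) ((Finset.univ.filter (fun q : V × V => ρ q.1 < cm q.1 q.2)).image
      (fun q => toLex (cm q.1 q.2 - ρ q.1, -(π - ρ q.1))))) (by
    intro z hz
    rw [Prod.Lex.lt_iff]
    left
    rcases Finset.mem_insert.1 hz with rfl | hz
    · exact one_pos
    · obtain ⟨q, hq, rfl⟩ := Finset.mem_image.1 hz
      exact sub_pos.2 (Finset.mem_filter.1 hq).2)
  have hε1 : ε < 1 := by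
    have := hε' _ (Finset.mem_insert_self _ _)
    simp at this; linarith
  have hε2 : ∀ i j, ρ i < cm i j → ρ i + ε * (π - ρ i) < cm i j := by
    intro i j h
    have := hε' _ (Finset.mem_insert_of_mem (Finset.mem_image.2
      ⟨(i, j), Finset.mem_filter.2 ⟨Finset.mem_univ _, h⟩, rfl⟩))
    simp at this; linarith
  let L : V → ℝ := fun i => ρ i + ε * (π - ρ i)
  have hL : ∀ i, L i = ρ i + ε * (π - ρ i) := fun _ => rfl
  have hL0 : ∀ i, 0 < L i := by
    intro i
    have h1 : 0 ≤ (1 - ε) * ρ i := mul_nonneg (by linarith) (ρ0 i)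
    have h2 : 0 < ε * π := mul_pos hε hpi
    rw [hL]; linarith
  have hLπ : ∀ i, L i ≤ π := by
    intro i
    have h1 : 0 ≤ (1 - ε) * (π - ρ i) := mul_nonneg (by linarith) (by linarith [ρπ i])
    rw [hL]; linarith
  have hLρ : ∀ i j, cm i j ≤ L i ↔ cm i j ≤ ρ i := by
    intro i j
    constructor
    · intro h
      by_contra hc
      have := hε2 i j (not_le.1 hc)
      rw [hL] at h; linarith
    · intro h
      have : 0 ≤ ε * (π - ρ i) := mul_nonneg hε.le (by linarith [ρπ i])
      rw [hL]; linarith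
  have hL2 : ∀ i, L i < 2 * π := fun i => by linarith [hLπ i]
  refine ⟨fun v => arcC (D v) (L v), ⟨fun v => ⟨_, _, hL0 v, hL2 v, rfl⟩, ?_⟩, ?_⟩
  · intro i j hij
    rw [arc_inter (hL0 i) (hL2 i) (hL0 j) (hL2 j)]
    change _ ↔ cm i j ≤ L i ∨ cm j i ≤ L j
    rw [hLρ, hLρ]
    constructor
    · exact F2 i j
    · rintro (h | h)
      · exact F1 i j hij h
      · exact (F1 j i hij.symm h).symm
  · intro i j hss
    have hij : i ≠ j := by
      rintro rfl
      exact (ssubset_irrefl _) hss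
    have hsub := hss.1
    have mem : ∀ u, 0 ≤ u → u ≤ L i → cmod (D i + u - D j) ≤ L j := by
      intro u h0 h1
      have : cmod (D i + u) ∈ arcC (D i) (L i) := by
        refine ⟨⟨cmod_nonneg _, cmod_lt _⟩, ?_⟩
        rw [cmod_cmod_sub, cmod_le_iff (hL2 i)]
        exact ⟨0, by simpa using h0, by simpa using h1⟩
      have := (hsub this).2
      rwa [cmod_cmod_sub] at this
    have ht : cm j i ≤ L j := by
      have := mem 0 le_rfl (hL0 i).le
      simpa using this
    have ht' := (hLρ j i).1 ht
    have h3 := F3 i j hij ht'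
    have htp := cmpos j i hij.symm
    have hlt : L j < cm j i + L i := by
      have h4 : (1 - ε) * (ρ j - cm j i) ≤ (1 - ε) * ρ i :=
        mul_le_mul_of_nonneg_left h3 (by linarith)
      have h5 : 0 < ε * cm j i := mul_pos hε htp
      rw [hL, hL]; linarith
    have h6 := mem ((L j - cm j i + L i) / 2) (by linarith [hL0 i]) (by linarith)
    have h7 : cmod (D i + (L j - cm j i + L i) / 2 - D j) = (L j + cm j i + L i) / 2 := by
      obtain ⟨n, hn⟩ := cmod_spec (D i - D j)
      refine cmod_unique (by linarith [hL0 i, hL0 j]) (by linarith [hLπ i, hLπ j]) n ?_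
      simp only [cm]
      linarith
    rw [h7] at h6
    linarith

end C

end PCA

/-- A complete signed graph has a valid drawing in the circumference iff its
positive subgraph is a proper circular arc graph. -/
theorem complete_valid_iff_proper_circular_arc {V : Type*} [Fintype V]
    (G : SignedGraph V)
    (hcomplete : ∀ i j : V, i ≠ j → G.pos.Adj i j ∨ G.neg.Adj i j) :
    (∃ D : V → ℝ, IsValidDrawing G D) ↔ IsProperCircularArcGraph G.pos := by
  exact ⟨fun ⟨D, hD⟩ => PCA.forward G hcomplete D hD, PCA.backward G⟩
end
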